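/- Let Q be a 4-dimensional prismatoid with bases Q+ and Q−. Then there exists a facial path Q+ = F_0, F_1, …, F_k = Q− from Q+ to Q− in the dual graph of Q such that at each step at least one new vertex of Q− is encountered: for every i ≥ 1, the facet F_i contains a vertex of Q− that is not contained in F_{i−1}. -/

import Mathlib

open scoped BigOperators

/-- Data defining a polyhedron `{z ∈ ℝ^d : A z ≥ b}` with rational data.
Under the `IsProper` assumption below it is full-dimensional with an
irredundant description, hence `d`-dimensional with exactly `f` facets. -/
structure PolyData (d f : ℕ) where
  A : Matrix (Fin f) (Fin d) ℚ
  b : Fin f → ℚ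

namespace PolyData

variable {d f : ℕ}

/-- The `i`-th row of `A` (outer normal of the `i`-th facet), as a real vector. -/
def row (P : PolyData d f) (i : Fin f) : Fin d → ℝ := fun j => (P.A i j : ℝ)

/-- The `i`-th right-hand side, as a real number. -/
def rhs (P : PolyData d f) (i : Fin f) : ℝ := (P.b i : ℝ)

/-- Value of the `i`-th linear form at `z`. -/
def eval (P : PolyData d f) (i : Fin f) (z : Fin d → ℝ) : ℝ := ∑ j, P.row i j * z j

/-- The feasible set `{z : A z ≥ b}`. -/
def toSet (P : PolyData d f) : Set (Fin d → ℝ) := {z | ∀ i, P.rhs i ≤ P.eval i z}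

/-- Indices of the constraints (facets) active (incident) at `z`. -/
def activeAt (P : PolyData d f) (z : Fin d → ℝ) : Set (Fin f) := {i | P.eval i z = P.rhs i}

/-- The `i`-th facet, as a subset of the polyhedron. -/
def facet (P : PolyData d f) (i : Fin f) : Set (Fin d → ℝ) :=
  {z ∈ P.toSet | P.eval i z = P.rhs i}

/-- The standing assumption: the polyhedron is full-dimensional and the
description is irredundant, i.e. every inequality is facet-defining. -/
def IsProper (P : PolyData d f) : Prop :=
  (∃ z, ∀ i, P.rhs i < P.eval i z) ∧
  ∀ i, ∃ z ∈ P.toSet, P.eval i z = P.rhs i ∧ ∀ i', i' ≠ i → P.rhs i' < P.eval i' z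

/-- A vertex: a feasible point whose active outer normals span `ℝ^d`. -/
def IsVertex (P : PolyData d f) (v : Fin d → ℝ) : Prop :=
  v ∈ P.toSet ∧ Submodule.span ℝ (P.row '' P.activeAt v) = ⊤

/-- A circuit direction of `P`: a nonzero `g` such that `A g` is
support-minimal in `{A x : x ≠ 0}` (taken here up to scaling). -/
def IsCircuit (P : PolyData d f) (g : Fin d → ℝ) : Prop :=
  g ≠ 0 ∧ ∀ x : Fin d → ℝ, x ≠ 0 →
    {i | P.eval i x ≠ 0} ⊆ {i | P.eval i g ≠ 0} →
    {i | P.eval i x ≠ 0} = {i | P.eval i g ≠ 0}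

/-- The set of circuits of `P`. -/
def circuits (P : PolyData d f) : Set (Fin d → ℝ) := {g | P.IsCircuit g}

/-- A (maximal) circuit walk `y 0, …, y k` of length `k`. -/
def IsCircuitWalk (P : PolyData d f) {k : ℕ} (y : Fin (k+1) → Fin d → ℝ) : Prop :=
  (∀ i, y i ∈ P.toSet) ∧
  ∀ i : Fin k, ∃ g ∈ P.circuits, ∃ α : ℝ, 0 < α ∧
    y i.succ = y i.castSucc + α • g ∧
    ∀ β : ℝ, α < β → y i.castSucc + β • g ∉ P.toSet

/-- The circuit distance from `u` to `v`: minimum length of a circuit walk. -/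
noncomputable def circuitDistance (P : PolyData d f) (u v : Fin d → ℝ) : ℕ∞ :=
  sInf {n : ℕ∞ | ∃ k : ℕ, n = (k : ℕ∞) ∧ ∃ y : Fin (k+1) → Fin d → ℝ,
    P.IsCircuitWalk y ∧ y 0 = u ∧ y (Fin.last k) = v}

/-- The circuit diameter: maximum circuit distance between two vertices. -/
noncomputable def circuitDiameter (P : PolyData d f) : ℕ∞ :=
  ⨆ (u : Fin d → ℝ) (v : Fin d → ℝ) (_ : P.IsVertex u) (_ : P.IsVertex v),
    P.circuitDistance u v

/-- `u` and `v` are joined by an edge of `P`. -/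
def IsEdge (P : PolyData d f) (u v : Fin d → ℝ) : Prop :=
  P.IsVertex u ∧ P.IsVertex v ∧ u ≠ v ∧
  segment ℝ u v = {z ∈ P.toSet | P.activeAt u ∩ P.activeAt v ⊆ P.activeAt z}

/-- An edge walk along vertices of `P`. -/
def IsEdgeWalk (P : PolyData d f) {k : ℕ} (y : Fin (k+1) → Fin d → ℝ) : Prop :=
  ∀ i : Fin k, P.IsEdge (y i.castSucc) (y i.succ)

/-- Combinatorial (edge) distance between two vertices. -/
noncomputable def edgeDistance (P : PolyData d f) (u v : Fin d → ℝ) : ℕ∞ :=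
  sInf {n : ℕ∞ | ∃ k : ℕ, n = (k : ℕ∞) ∧ ∃ y : Fin (k+1) → Fin d → ℝ,
    P.IsEdgeWalk y ∧ y 0 = u ∧ y (Fin.last k) = v}

/-- Combinatorial (edge) diameter. -/
noncomputable def edgeDiameter (P : PolyData d f) : ℕ∞ :=
  ⨆ (u : Fin d → ℝ) (v : Fin d → ℝ) (_ : P.IsVertex u) (_ : P.IsVertex v),
    P.edgeDistance u v

end PolyData

/-- `Δ_E(f,d)`: maximum combinatorial diameter of a `d`-dimensional
polyhedron with `f` facets. -/
noncomputable def maxEdgeDiameter (f d : ℕ) : ℕ∞ :=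
  ⨆ (P : PolyData d f) (_ : P.IsProper), P.edgeDiameter

/-- `Δ_C(f,d)`: maximum circuit diameter of a `d`-dimensional polyhedron
with `f` facets. -/
noncomputable def maxCircuitDiameter (f d : ℕ) : ℕ∞ :=
  ⨆ (P : PolyData d f) (_ : P.IsProper), P.circuitDiameter

/-- `Δ_C^u(f,d)`: maximum circuit diameter of an unbounded `d`-dimensional
polyhedron with `f` facets. -/
noncomputable def maxUnboundedCircuitDiameter (f d : ℕ) : ℕ∞ :=
  ⨆ (P : PolyData d f) (_ : P.IsProper ∧ ¬ Bornology.IsBounded P.toSet),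
    P.circuitDiameter

namespace PolyData

variable {d f : ℕ}

/-- A walk is simple if each step enters exactly one new facet. -/
def IsSimpleWalk (P : PolyData d f) {k : ℕ} (y : Fin (k+1) → Fin d → ℝ) : Prop :=
  ∀ i : Fin k, (P.activeAt (y i.succ) \ P.activeAt (y i.castSucc)).ncard = 1

/-- `P` is `C`-simple: all circuit walks of length at most `Δ_E(f,d)` are simple. -/
def IsCSimple (P : PolyData d f) : Prop :=
  ∀ k : ℕ, (k : ℕ∞) ≤ maxEdgeDiameter f d →
    ∀ y : Fin (k+1) → Fin d → ℝ, P.IsCircuitWalk y → P.IsSimpleWalk y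

/-- A non-revisiting walk: each step enters a facet containing no earlier
point of the walk. -/
def IsNonRevisiting (P : PolyData d f) {k : ℕ} (y : Fin (k+1) → Fin d → ℝ) : Prop :=
  ∀ i : Fin k, ∃ j : Fin f, j ∈ P.activeAt (y i.succ) ∧
    ∀ i' : Fin (k+1), i' ≤ i.castSucc → j ∉ P.activeAt (y i')

/-- `P` is a simple polyhedron: every vertex lies on exactly `d` facets. -/
def IsSimplePoly (P : PolyData d f) : Prop :=
  ∀ v, P.IsVertex v → (P.activeAt v).ncard = d

end PolyData

/-- Append a last coordinate: `(z, t) ∈ ℝ^{d+1}`. -/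
def snocVec {d : ℕ} (z : Fin d → ℝ) (t : ℝ) : Fin (d+1) → ℝ := Fin.snoc z t

namespace PolyData

variable {d f : ℕ}

/-- `W` is a wedge on `P` over the facet with index `i₀`:
`W = H^≤ ∩ (P × [0,∞))`, where the boundary hyperplane `H = {w : a·w = β}`
of the halfspace `H^≤` contains `P × {0}` on its feasible side, meets the
interior of `P × [0,∞)`, and meets `P × {0}` exactly in the facet `i₀`. -/
def IsWedgeOver (W : PolyData (d+1) (f+1)) (P : PolyData d f) (i₀ : Fin f) : Prop :=
  ∃ (a : Fin (d+1) → ℝ) (β : ℝ),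
    (∀ z ∈ P.toSet, ∑ j, a j * snocVec z 0 j ≤ β) ∧
    (∃ z, (∀ i, P.rhs i < P.eval i z) ∧ ∃ t : ℝ, 0 < t ∧ ∑ j, a j * snocVec z t j = β) ∧
    (∀ z ∈ P.toSet, (∑ j, a j * snocVec z 0 j = β ↔ z ∈ P.facet i₀)) ∧
    W.toSet = {w | ∑ j, a j * w j ≤ β} ∩
      {w | ∃ z ∈ P.toSet, ∃ t : ℝ, 0 ≤ t ∧ w = snocVec z t}

/-- `P` is wedge-simple: it is `C`-simple and over every facet there is a
`C`-simple wedge. -/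
def IsWedgeSimple (P : PolyData d f) : Prop :=
  P.IsCSimple ∧ ∀ i₀ : Fin f, ∃ W : PolyData (d+1) (f+1),
    W.IsProper ∧ W.IsWedgeOver P i₀ ∧ W.IsCSimple

end PolyData

/-- `k`-wedge-simplicity: `0`-wedge-simple means `C`-simple, and `P` is
`(k+1)`-wedge-simple if it is `C`-simple and over every facet there is a
`k`-wedge-simple wedge.  In particular `1`-wedge-simple = wedge-simple. -/
def IsKWedgeSimpleAux : ℕ → (d f : ℕ) → PolyData d f → Prop
  | 0, _, _, P => P.IsCSimple
  | (k+1), d, f, P => P.IsCSimple ∧ ∀ i₀ : Fin f,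
      ∃ W : PolyData (d+1) (f+1), W.IsProper ∧ W.IsWedgeOver P i₀ ∧
        IsKWedgeSimpleAux k (d+1) (f+1) W

def IsKWedgeSimple (k : ℕ) {d f : ℕ} (P : PolyData d f) : Prop :=
  IsKWedgeSimpleAux k d f P

namespace PolyData

variable {d : ℕ}

/-- `(P, u, v)` is a Dantzig figure: a `d`-dimensional polyhedron with `2d`
facets, `d` of which are incident to the vertex `u` and the other `d` to the
vertex `v`. -/
def IsDantzigFigure (P : PolyData d (2*d)) (u v : Fin d → ℝ) : Prop :=
  P.IsVertex u ∧ P.IsVertex v ∧ Disjoint (P.activeAt u) (P.activeAt v) ∧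
  P.activeAt u ∪ P.activeAt v = Set.univ ∧
  (P.activeAt u).ncard = d ∧ (P.activeAt v).ncard = d

end PolyData

/-- The (exposed) faces of a polyhedron, each obtained by turning a subset of
the inequalities into equations. -/
def PolyData.faces {d f : ℕ} (P : PolyData d f) : Set (Set (Fin d → ℝ)) :=
  {F | ∃ S : Set (Fin f), F = {z ∈ P.toSet | S ⊆ P.activeAt z}}

/-- Combinatorial equivalence: an inclusion-preserving bijection between the
face lattices. -/
def CombEquiv {d f d' f' : ℕ} (P : PolyData d f) (Q : PolyData d' f') : Prop :=
  ∃ φ : Set (Fin d → ℝ) → Set (Fin d' → ℝ),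
    Set.BijOn φ P.faces Q.faces ∧
    ∀ F ∈ P.faces, ∀ G ∈ P.faces, (F ⊆ G ↔ φ F ⊆ φ G)

/-- Two facets are adjacent if they share a ridge (a codimension-2 face). -/
def PolyData.AdjacentFacets {d f : ℕ} (P : PolyData d f) (i j : Fin f) : Prop :=
  i ≠ j ∧ Module.finrank ℝ (affineSpan ℝ (P.facet i ∩ P.facet j)).direction = d - 2

/-- The Klee–Walkup polyhedron `U_4`. -/
def U4 : PolyData 4 8 where
  A := !![-6,-3,0,1; -3,-6,1,0; -35,-45,6,3; -45,-35,3,6;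
          1,0,0,0; 0,1,0,0; 0,0,1,0; 0,0,0,1]
  b := ![-1,-1,-8,-8,0,0,0,0]

namespace PolyData

variable {d f : ℕ}

/-- The slack of the `i`-th inequality at `z`. -/
def slack (P : PolyData d f) (i : Fin f) (z : Fin d → ℝ) : ℝ := P.eval i z - P.rhs i

/-- The `i`-th linear form of `P` as a linear map. -/
def evalLin (P : PolyData d f) (i : Fin f) : (Fin d → ℝ) →ₗ[ℝ] ℝ where
  toFun := P.eval i
  map_add' x y := by simp [eval, mul_add, Finset.sum_add_distrib]
  map_smul' c x := by
    simp only [eval, Pi.smul_apply, smul_eq_mul, RingHom.id_apply, Finset.mul_sum]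
    exact Finset.sum_congr rfl fun j _ => by ring

lemma eval_add (P : PolyData d f) (i : Fin f) (x y : Fin d → ℝ) :
    P.eval i (x + y) = P.eval i x + P.eval i y := (P.evalLin i).map_add x y

lemma eval_sub (P : PolyData d f) (i : Fin f) (x y : Fin d → ℝ) :
    P.eval i (x - y) = P.eval i x - P.eval i y := (P.evalLin i).map_sub x y

lemma eval_smul (P : PolyData d f) (i : Fin f) (c : ℝ) (x : Fin d → ℝ) :
    P.eval i (c • x) = c * P.eval i x := (P.evalLin i).map_smul c x

lemma eval_zero (P : PolyData d f) (i : Fin f) : P.eval i 0 = 0 := (P.evalLin i).map_zero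

lemma continuous_eval (P : PolyData d f) (i : Fin f) : Continuous (P.eval i) := by
  unfold eval; fun_prop

lemma continuous_slack (P : PolyData d f) (i : Fin f) : Continuous (P.slack i) :=
  (P.continuous_eval i).sub continuous_const

lemma slack_lineMap (P : PolyData d f) (i : Fin f) (x y : Fin d → ℝ) (t : ℝ) :
    P.slack i (x + t • (y - x)) = (1 - t) * P.slack i x + t * P.slack i y := by
  simp only [slack, eval_add, eval_smul, eval_sub]; ring

lemma slack_add_smul (P : PolyData d f) (i : Fin f) (x v : Fin d → ℝ) (t : ℝ) :
    P.slack i (x + t • v) = P.slack i x + t * P.eval i v := by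
  simp only [slack, eval_add, eval_smul]; ring

lemma mem_toSet_iff_slack (P : PolyData d f) (z : Fin d → ℝ) :
    z ∈ P.toSet ↔ ∀ i, 0 ≤ P.slack i z := by simp [toSet, slack]

lemma mem_facet_iff_slack (P : PolyData d f) (i : Fin f) (z : Fin d → ℝ) :
    z ∈ P.facet i ↔ z ∈ P.toSet ∧ P.slack i z = 0 := by
  simp [facet, slack, sub_eq_zero]

lemma IsProper.exists_interior {P : PolyData d f} (hP : P.IsProper) :
    ∃ z, ∀ i, 0 < P.slack i z := by
  obtain ⟨z, hz⟩ := hP.1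
  exact ⟨z, fun i => sub_pos.2 (hz i)⟩

lemma IsProper.exists_relint {P : PolyData d f} (hP : P.IsProper) (i : Fin f) :
    ∃ z, P.slack i z = 0 ∧ ∀ j, j ≠ i → 0 < P.slack j z := by
  obtain ⟨z, -, h, h'⟩ := hP.2 i
  exact ⟨z, sub_eq_zero.2 h, fun j hj => sub_pos.2 (h' j hj)⟩

/-- A nonempty bounded polyhedron has no nonzero recession direction. -/
lemma eq_zero_of_recession {P : PolyData d f} (hb : Bornology.IsBounded P.toSet)
    {o v : Fin d → ℝ} (ho : o ∈ P.toSet) (hv : ∀ i, 0 ≤ P.eval i v) : v = 0 := by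
  by_contra hne
  have hpos : 0 < ‖v‖ := norm_pos_iff.2 hne
  obtain ⟨R, hR⟩ := isBounded_iff_forall_norm_le.1 hb
  have hR0 : 0 ≤ R := (norm_nonneg o).trans (hR o ho)
  set t := (R + ‖o‖ + 1) / ‖v‖ with ht
  have ht0 : 0 ≤ t := by positivity
  have hmem : o + t • v ∈ P.toSet := by
    rw [mem_toSet_iff_slack] at ho ⊢
    intro i
    rw [slack_add_smul]
    exact add_nonneg (ho i) (mul_nonneg ht0 (hv i))
  have h1 := hR _ hmem
  have h2 : ‖t • v‖ ≤ ‖o + t • v‖ + ‖o‖ := by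
    simpa using norm_sub_le (o + t • v) o
  rw [norm_smul, Real.norm_of_nonneg ht0, ht, div_mul_cancel₀ _ hpos.ne'] at h2
  linarith

/-- If the active normals at `z` do not span, some nonzero direction preserves all of them. -/
lemma exists_direction_of_span_ne_top {P : PolyData d f} {S : Set (Fin f)}
    (h : Submodule.span ℝ (P.row '' S) ≠ ⊤) : ∃ v : Fin d → ℝ, v ≠ 0 ∧ ∀ i ∈ S, P.eval i v = 0 := by
  obtain ⟨φ, hφ, hle⟩ := Submodule.exists_le_ker_of_lt_top _ (lt_top_iff_ne_top.2 h)
  have key : ∀ x : Fin d → ℝ, φ x = ∑ j, x j * φ (fun k => if j = k then 1 else 0) := fun x => by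
    simpa using LinearMap.pi_apply_eq_sum_univ φ x
  refine ⟨fun j => φ (fun k => if j = k then 1 else 0), fun h0 => hφ ?_, fun i hi => ?_⟩
  · refine LinearMap.ext fun x => ?_
    rw [key, LinearMap.zero_apply]
    exact Finset.sum_eq_zero fun j _ => mul_eq_zero_of_right _ (congrFun h0 j)
  · have := hle (Submodule.subset_span ⟨i, hi, rfl⟩)
    rw [LinearMap.mem_ker, key] at this
    exact this

/-- A facet of a bounded polyhedron which is not contained in another one has a vertex
outside that other one. -/
lemma exists_vertex_of_slack_pos {P : PolyData d f} (hb : Bornology.IsBounded P.toSet)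
    {g k : Fin f} {x : Fin d → ℝ} (hx : x ∈ P.facet g) (hk : 0 < P.slack k x) :
    ∃ w, P.IsVertex w ∧ w ∈ P.facet g ∧ 0 < P.slack k w := by
  classical
  let act : (Fin d → ℝ) → Finset (Fin f) := fun z => Finset.univ.filter fun i => P.slack i z = 0
  let T : Set (Fin d → ℝ) := {z | z ∈ P.facet g ∧ 0 < P.slack k z}
  have hfin : (act '' T).Finite := Set.toFinite _
  obtain ⟨_, ⟨⟨w, hw, rfl⟩, hmax⟩⟩ :=
    hfin.exists_maximal ⟨_, x, (⟨hx, hk⟩ : x ∈ T), rfl⟩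
  refine ⟨w, ⟨hw.1.1, ?_⟩, hw.1, hw.2⟩
  by_contra hspan
  obtain ⟨v, hv0, hv⟩ := exists_direction_of_span_ne_top hspan
  obtain ⟨v, hv0, hv, hkv⟩ : ∃ v : Fin d → ℝ, v ≠ 0 ∧ (∀ i ∈ P.activeAt w, P.eval i v = 0) ∧
      0 ≤ P.eval k v := by
    rcases le_total 0 (P.eval k v) with h | h
    · exact ⟨v, hv0, hv, h⟩
    · refine ⟨(-1 : ℝ) • v, by simpa using hv0, fun i hi => ?_, ?_⟩
      · rw [eval_smul, hv i hi, mul_zero]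
      · rw [eval_smul]; linarith
  have hw0 := (P.mem_toSet_iff_slack w).1 hw.1.1
  let N : Finset (Fin f) := Finset.univ.filter fun i => P.eval i v < 0
  have hN : N.Nonempty := by
    by_contra hN
    refine hv0 (eq_zero_of_recession hb hw.1.1 fun i => ?_)
    by_contra hi
    exact hN ⟨i, by simpa [N] using hi⟩
  obtain ⟨m, hm, hmin⟩ := N.exists_min_image (fun i => P.slack i w / (-P.eval i v)) hN
  have hmneg : P.eval m v < 0 := by simpa [N] using hm
  set t := P.slack m w / (-P.eval m v) with ht
  have ht0 : 0 ≤ t := div_nonneg (hw0 m) (by linarith)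
  have hmem : w + t • v ∈ P.toSet := by
    rw [mem_toSet_iff_slack]
    intro i
    rw [slack_add_smul]
    rcases lt_or_ge (P.eval i v) 0 with hi | hi
    · have := hmin i (by simpa [N] using hi)
      rw [le_div_iff₀ (by linarith)] at this
      linarith
    · exact add_nonneg (hw0 i) (mul_nonneg ht0 hi)
  have hactive : ∀ i, P.slack i w = 0 → P.eval i v = 0 := fun i hi => hv i (sub_eq_zero.1 hi)
  have hT : w + t • v ∈ T := by
    refine ⟨(P.mem_facet_iff_slack g _).2 ⟨hmem, ?_⟩, ?_⟩
    · have hg := ((P.mem_facet_iff_slack g _).1 hw.1).2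
      rw [slack_add_smul, hg, hactive g hg, mul_zero, add_zero]
    · rw [slack_add_smul]
      exact add_pos_of_pos_of_nonneg hw.2 (mul_nonneg ht0 hkv)
  have hle : act w ≤ act (w + t • v) := by
    intro i hi
    have hi' : P.slack i w = 0 := by simpa [act] using hi
    simp [act, slack_add_smul, hi', hactive i hi']
  have hm0 : m ∈ act (w + t • v) := by
    have : P.slack m w + t * P.eval m v = 0 := by
      rw [ht]; field_simp [hmneg.ne]; ring
    simpa [act, slack_add_smul] using this
  have hm1 : P.slack m w = 0 := by
    simpa [act] using hmax ⟨_, hT, rfl⟩ hle hm0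
  exact hmneg.ne (hactive m hm1)

/-- The pair of linear forms of `g` and `k`. -/
def evalPair (P : PolyData d f) (g k : Fin f) : (Fin d → ℝ) →ₗ[ℝ] ℝ × ℝ :=
  (P.evalLin g).prod (P.evalLin k)

lemma mem_ker_evalPair (P : PolyData d f) (g k : Fin f) (v : Fin d → ℝ) :
    v ∈ LinearMap.ker (P.evalPair g k) ↔ P.eval g v = 0 ∧ P.eval k v = 0 := by
  exact Prod.mk_eq_zero

/-- Two facets through a point lying on no further facet are adjacent. -/
lemma IsProper.adjacentFacets {P : PolyData d f} (hP : P.IsProper) {g k : Fin f} (hne : k ≠ g)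
    {x : Fin d → ℝ} (hg : P.slack g x = 0) (hk : P.slack k x = 0)
    (hx : ∀ i, i ≠ g → i ≠ k → 0 < P.slack i x) : P.AdjacentFacets k g := by
  refine ⟨hne, ?_⟩
  have hxQ : x ∈ P.toSet := by
    rw [mem_toSet_iff_slack]
    intro i
    by_cases h1 : i = g
    · exact h1 ▸ hg.ge
    by_cases h2 : i = k
    · exact h2 ▸ hk.ge
    exact (hx i h1 h2).le
  have hxF : x ∈ P.facet k ∩ P.facet g :=
    ⟨(P.mem_facet_iff_slack k x).2 ⟨hxQ, hk⟩, (P.mem_facet_iff_slack g x).2 ⟨hxQ, hg⟩⟩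
  have hdir : (affineSpan ℝ (P.facet k ∩ P.facet g)).direction =
      LinearMap.ker (P.evalPair g k) := by
    rw [direction_affineSpan]
    apply le_antisymm
    · rw [vectorSpan_def, Submodule.span_le]
      rintro _ ⟨a, ha, b, hb, rfl⟩
      rw [SetLike.mem_coe, mem_ker_evalPair]
      dsimp only
      rw [vsub_eq_sub, eval_sub, eval_sub, ha.1.2, ha.2.2, hb.1.2, hb.2.2]
      simp
    · intro v hv
      rw [mem_ker_evalPair] at hv
      have hev : ∀ᶠ t : ℝ in nhdsWithin 0 (Set.Ioi 0), ∀ i, i ≠ g → i ≠ k →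
          0 < P.slack i (x + t • v) := by
        rw [Filter.eventually_all]
        intro i
        by_cases h1 : i = g
        · simp [h1]
        by_cases h2 : i = k
        · simp [h2]
        have hc : Continuous fun t : ℝ => P.slack i (x + t • v) :=
          (P.continuous_slack i).comp (by fun_prop)
        have := hc.continuousAt (x := 0) |>.eventually
          (lt_mem_nhds (a := 0) (by simpa using hx i h1 h2))
        exact (this.filter_mono nhdsWithin_le_nhds).mono fun t ht _ _ => ht
      obtain ⟨t, ht, ht0⟩ := (hev.and self_mem_nhdsWithin).exists
      have ht0 : 0 < t := ht0
      have e1 : P.slack g (x + t • v) = 0 := by rw [slack_add_smul, hg, hv.1]; simp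
      have e2 : P.slack k (x + t • v) = 0 := by rw [slack_add_smul, hk, hv.2]; simp
      have hmem : x + t • v ∈ P.toSet := by
        rw [mem_toSet_iff_slack]
        intro i
        by_cases h1 : i = g
        · exact h1 ▸ e1.ge
        by_cases h2 : i = k
        · exact h2 ▸ e2.ge
        exact (ht i h1 h2).le
      have hsub : (x + t • v) -ᵥ x ∈ vectorSpan ℝ (P.facet k ∩ P.facet g) :=
        vsub_mem_vectorSpan ℝ ⟨(P.mem_facet_iff_slack k _).2 ⟨hmem, e2⟩,
          (P.mem_facet_iff_slack g _).2 ⟨hmem, e1⟩⟩ hxF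
      rw [vsub_eq_sub, add_sub_cancel_left] at hsub
      simpa [smul_smul, ht0.ne'] using Submodule.smul_mem _ t⁻¹ hsub
  have hsurj : Function.Surjective (P.evalPair g k) := by
    obtain ⟨a, ha, ha'⟩ := hP.exists_relint g
    obtain ⟨b, hb, hb'⟩ := hP.exists_relint k
    have ha' := ha' k hne
    have hb' := hb' g hne.symm
    rintro ⟨s, t⟩
    refine ⟨(s / P.slack g b) • (b - x) + (t / P.slack k a) • (a - x), ?_⟩
    have h1 : P.eval g a = P.eval g x := by simp only [slack] at *; linarith
    have h2 : P.eval k b = P.eval k x := by simp only [slack] at *; linarith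
    have h3 : P.eval g b - P.eval g x = P.slack g b := by simp only [slack] at *; linarith
    have h4 : P.eval k a - P.eval k x = P.slack k a := by simp only [slack] at *; linarith
    change (P.eval g _, P.eval k _) = _
    rw [eval_add, eval_add, eval_smul, eval_smul, eval_smul, eval_smul, eval_sub, eval_sub,
      eval_sub, eval_sub, h1, h2, h3, h4]
    simp [hb'.ne', ha'.ne']
  have hrank := LinearMap.finrank_range_add_finrank_ker (P.evalPair g k)
  rw [LinearMap.range_eq_top.2 hsurj, finrank_top] at hrank
  simp only [Module.finrank_prod, Module.finrank_self, Module.finrank_fin_fun] at hrank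
  rw [hdir]
  omega

/-- A nonempty intersection of two facets has a relatively interior point. -/
lemma exists_minimal_active {P : PolyData d f} {g p : Fin f} (h : (P.facet g ∩ P.facet p).Nonempty) :
    ∃ q ∈ P.facet g ∩ P.facet p, ∀ i, P.slack i q = 0 →
      ∀ x ∈ P.facet g ∩ P.facet p, P.slack i x = 0 := by
  suffices H : ∀ S : Finset (Fin f), ∃ q ∈ P.facet g ∩ P.facet p, ∀ i ∈ S, P.slack i q = 0 →
      ∀ x ∈ P.facet g ∩ P.facet p, P.slack i x = 0 by
    simpa using H Finset.univ
  intro S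
  induction S using Finset.induction_on with
  | empty => exact ⟨h.some, h.some_mem, by simp⟩
  | insert j S hj ih =>
    obtain ⟨q, hq, hS⟩ := ih
    by_cases hjx : ∀ x ∈ P.facet g ∩ P.facet p, P.slack j x = 0
    · refine ⟨q, hq, fun i hi => ?_⟩
      rcases Finset.mem_insert.1 hi with rfl | hi
      · exact fun _ => hjx
      · exact hS i hi
    · push Not at hjx
      obtain ⟨x, hx, hxj⟩ := hjx
      have hq0 := (P.mem_toSet_iff_slack q).1 hq.1.1
      have hx0 := (P.mem_toSet_iff_slack x).1 hx.1.1
      have hs : ∀ i, P.slack i (q + (1 / 2 : ℝ) • (x - q)) =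
          (1 / 2) * P.slack i q + (1 / 2) * P.slack i x := fun i => by
        rw [slack_lineMap]; ring
      have hmem : q + (1 / 2 : ℝ) • (x - q) ∈ P.toSet := by
        rw [mem_toSet_iff_slack]
        intro i
        rw [hs]
        linarith [hq0 i, hx0 i]
      simp only [Set.mem_inter_iff, mem_facet_iff_slack] at hq hx
      refine ⟨q + (1 / 2 : ℝ) • (x - q), ?_, fun i hi h0 => ?_⟩
      · simp only [Set.mem_inter_iff, mem_facet_iff_slack]
        refine ⟨⟨hmem, ?_⟩, hmem, ?_⟩
        · rw [hs, hq.1.2, hx.1.2]; ring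
        · rw [hs, hq.2.2, hx.2.2]; ring
      · rw [hs] at h0
        have h1 := hq0 i
        have h2 := hx0 i
        rcases Finset.mem_insert.1 hi with rfl | hi
        · exact absurd (by linarith) hxj
        · exact hS i hi (by linarith)

/-- Finitely many affine conditions, each of which fails somewhere on the hyperplane of `g`,
fail simultaneously at some point of any nonempty relatively open subset of it. -/
lemma exists_generic_point {P : PolyData d f} {g : Fin f} {ι : Type*}
    (h : ι → (Fin d → ℝ) → ℝ) (hc : ∀ j, Continuous (h j))
    (haff : ∀ j x y t, h j (x + t • (y - x)) = (1 - t) * h j x + t * h j y)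
    (S : Finset ι) (hS : ∀ j ∈ S, ∃ q, P.slack g q = 0 ∧ h j q ≠ 0)
    {U : Set (Fin d → ℝ)} (hU : IsOpen U) {y : Fin d → ℝ} (hyU : y ∈ U) (hy : P.slack g y = 0) :
    ∃ y' ∈ U, P.slack g y' = 0 ∧ ∀ j ∈ S, h j y' ≠ 0 := by
  classical
  induction S using Finset.induction_on with
  | empty => exact ⟨y, hyU, hy, by simp⟩
  | insert j S hj ih =>
    obtain ⟨x, hxU, hx, hxS⟩ := ih fun i hi => hS i (Finset.mem_insert_of_mem hi)
    by_cases hjx : h j x = 0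
    swap
    · refine ⟨x, hxU, hx, fun i hi => ?_⟩
      rcases Finset.mem_insert.1 hi with rfl | hi
      · exact hjx
      · exact hxS i hi
    obtain ⟨q, hq, hjq⟩ := hS j (Finset.mem_insert_self j S)
    have hcont : Continuous fun t : ℝ => x + t • (q - x) := by fun_prop
    have hev1 : ∀ᶠ t : ℝ in nhds 0, x + t • (q - x) ∈ U :=
      hcont.continuousAt.eventually (by simpa using hU.mem_nhds hxU)
    have hev2 : ∀ᶠ t : ℝ in nhds 0, ∀ i ∈ S, h i (x + t • (q - x)) ≠ 0 := by
      rw [Filter.eventually_all_finset]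
      intro i hi
      exact ((hc i).comp hcont).continuousAt.eventually_ne (by simpa using hxS i hi)
    obtain ⟨t, ⟨ht1, ht2⟩, ht0⟩ :=
      (((hev1.and hev2).filter_mono nhdsWithin_le_nhds).and
        (self_mem_nhdsWithin : Set.Ioi (0 : ℝ) ∈ nhdsWithin 0 (Set.Ioi 0))).exists
    refine ⟨_, ht1, by rw [slack_lineMap, hx, hq]; ring, fun i hi => ?_⟩
    rcases Finset.mem_insert.1 hi with rfl | hi
    · rw [haff, hjx, mul_zero, zero_add]
      exact mul_ne_zero (ne_of_gt ht0) hjq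
    · exact ht2 i hi

/-- In a proper polyhedron, no positive combination `a φ_i = b φ_j` of two distinct slacks holds
on the whole hyperplane of a third facet. -/
lemma IsProper.exists_slack_comb_ne {P : PolyData d f} (hP : P.IsProper) {g i j : Fin f}
    (hig : i ≠ g) (hjg : j ≠ g) (hij : i ≠ j) {a b : ℝ} (ha : 0 < a) (hb : 0 < b) :
    ∃ q, P.slack g q = 0 ∧ a * P.slack i q - b * P.slack j q ≠ 0 := by
  by_contra! hall
  obtain ⟨o, ho⟩ := hP.exists_interior
  obtain ⟨x, hx, hx'⟩ := hP.exists_relint i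
  obtain ⟨y, hy, hy'⟩ := hP.exists_relint j
  obtain ⟨u, hu, hu'⟩ := hP.exists_relint g
  have hxg := hx' g hig.symm
  have hyg := hy' g hjg.symm
  have hxj := hx' j hij.symm
  have hyi := hy' i hij
  set q : Fin d → ℝ := u + (P.slack g y • (x - u) - P.slack g x • (y - u)) with hqdef
  have hq : ∀ m, P.slack m q = (1 - P.slack g y + P.slack g x) * P.slack m u
      + P.slack g y * P.slack m x - P.slack g x * P.slack m y := fun m => by
    simp only [hqdef, slack, eval_add, eval_sub, eval_smul]; ring
  have h1 := hall q (by rw [hq, hu]; ring)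
  have h2 := hall u hu
  rw [hq, hq, hx, hy] at h1
  have h3 : 0 < P.slack g y * P.slack j x := mul_pos hyg hxj
  have h4 : 0 < P.slack g x * P.slack i y := mul_pos hxg hyi
  have h5 := mul_pos hb h3
  have h6 := mul_pos ha h4
  have h7 : (1 - P.slack g y + P.slack g x) * (a * P.slack i u - b * P.slack j u) = 0 := by
    rw [h2, mul_zero]
  nlinarith

/-- From every facet `g ≠ p` one can pass to an adjacent facet containing `g ∩ p` which is met
earlier on the line through an interior point `o` and a relatively interior point `z` of `p`. -/
lemma IsProper.exists_adjacent_descent {P : PolyData d f} (hd : 2 < d) (hP : P.IsProper)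
    (hb : Bornology.IsBounded P.toSet) {g p : Fin f} (hne : g ≠ p) {z o : Fin d → ℝ}
    (hzp : P.slack p z = 0) (hz : ∀ i, i ≠ p → 0 < P.slack i z) (ho : ∀ i, 0 < P.slack i o) :
    ∃ k, P.AdjacentFacets k g ∧ P.facet g ∩ P.facet p ⊆ P.facet k ∧
      P.slack k z / P.slack k o < P.slack g z / P.slack g o := by
  classical
  have hgz := hz g hne
  set A : Fin f → ℝ := fun i => P.slack g z * P.slack i o - P.slack g o * P.slack i z with hA
  have hAp : 0 < A p := by simp only [hA, hzp]; nlinarith [mul_pos hgz (ho p)]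
  have hAg : A g = 0 := by simp only [hA]; ring
  let N : Finset (Fin f) := Finset.univ.filter fun i => 0 < A i
  have hN : ∀ i, i ∈ N ↔ 0 < A i := fun i => by simp [N]
  have hNg : ∀ i ∈ N, i ≠ g := by
    rintro i hi rfl
    exact ((hN _).1 hi).ne' hAg
  obtain ⟨y₀, hy₀, hy₀'⟩ := hP.exists_relint g
  -- an open set in which the ratio test only selects facets through `g ∩ p`
  obtain ⟨U, hUo, ⟨y₁, hy₁U, hy₁, hy₁'⟩, hUsel⟩ : ∃ U : Set (Fin d → ℝ), IsOpen U ∧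
      (∃ y ∈ U, P.slack g y = 0 ∧ ∀ i, i ≠ g → 0 < P.slack i y) ∧
      ∀ y ∈ U, ∀ k, P.slack k y * A p ≤ P.slack p y * A k →
        ∀ x ∈ P.facet g ∩ P.facet p, P.slack k x = 0 := by
    rcases (P.facet g ∩ P.facet p).eq_empty_or_nonempty with he | hn
    · exact ⟨Set.univ, isOpen_univ, ⟨y₀, trivial, hy₀, hy₀'⟩, by simp [he]⟩
    obtain ⟨q, hq, hqmin⟩ := exists_minimal_active hn
    have hq0 := (P.mem_toSet_iff_slack q).1 hq.1.1
    have hqg := ((P.mem_facet_iff_slack _ _).1 hq.1).2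
    have hqp := ((P.mem_facet_iff_slack _ _).1 hq.2).2
    let U : Set (Fin d → ℝ) :=
      ⋂ i : {i : Fin f // 0 < P.slack i q}, {y | P.slack p y * A i < P.slack i y * A p}
    have hUo : IsOpen U := isOpen_iInter_of_finite fun i =>
      isOpen_lt ((P.continuous_slack p).mul continuous_const)
        ((P.continuous_slack i).mul continuous_const)
    have hqU : q ∈ U := by
      simp only [U, Set.mem_iInter, Set.mem_ofPred_eq, hqp]
      intro i
      rw [zero_mul]
      exact mul_pos i.2 hAp
    refine ⟨U, hUo, ?_, fun y hy k hk => ?_⟩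
    · have hcont : Continuous fun t : ℝ => q + t • (y₀ - q) := by fun_prop
      have hev : ∀ᶠ t : ℝ in nhds 0, q + t • (y₀ - q) ∈ U :=
        hcont.continuousAt.eventually (by simpa using hUo.mem_nhds hqU)
      have hev' : ∀ᶠ t : ℝ in nhds 0, t < 1 := gt_mem_nhds one_pos
      obtain ⟨t, ⟨ht, ht1⟩, ht0⟩ :=
        (((hev.and hev').filter_mono nhdsWithin_le_nhds).and
          (self_mem_nhdsWithin : Set.Ioi (0 : ℝ) ∈ nhdsWithin 0 (Set.Ioi 0))).exists
      have ht0 : 0 < t := ht0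
      refine ⟨_, ht, by rw [slack_lineMap, hqg, hy₀]; ring, fun i hi => ?_⟩
      rw [slack_lineMap]
      exact add_pos_of_nonneg_of_pos (mul_nonneg (by linarith) (hq0 i)) (mul_pos ht0 (hy₀' i hi))
    · apply hqmin
      by_contra hkq
      have := Set.mem_iInter.1 hy ⟨k, lt_of_le_of_ne (hq0 k) (Ne.symm hkq)⟩
      exact absurd hk (not_le.2 this)
  -- a generic point near `y₁`
  let V : Set (Fin d → ℝ) := U ∩ ⋂ i : {i : Fin f // i ≠ g}, {y | 0 < P.slack i y}
  have hVo : IsOpen V := hUo.inter <| isOpen_iInter_of_finite fun i =>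
    isOpen_lt continuous_const (P.continuous_slack i)
  obtain ⟨y, hyV, hyg, hgen⟩ := exists_generic_point (P := P) (g := g)
    (fun (ij : Fin f × Fin f) x => A ij.2 * P.slack ij.1 x - A ij.1 * P.slack ij.2 x)
    (fun ij => (continuous_const.mul (P.continuous_slack _)).sub
      (continuous_const.mul (P.continuous_slack _)))
    (fun ij x y t => by simp only [slack_lineMap]; ring)
    ((N ×ˢ N).filter fun ij => ij.1 ≠ ij.2)
    (fun ij hij => by
      simp only [Finset.mem_filter, Finset.mem_product] at hij
      exact hP.exists_slack_comb_ne (hNg _ hij.1.1) (hNg _ hij.1.2) hij.2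
        ((hN _).1 hij.1.2) ((hN _).1 hij.1.1))
    hVo (y := y₁) ⟨hy₁U, Set.mem_iInter.2 fun i => hy₁' i i.2⟩ hy₁
  have hypos : ∀ i, i ≠ g → 0 < P.slack i y := fun i hi => Set.mem_iInter.1 hyV.2 ⟨i, hi⟩
  obtain ⟨k, hkN, hkmin⟩ := N.exists_min_image (fun i => P.slack i y / A i) ⟨p, (hN p).2 hAp⟩
  have hAk := (hN k).1 hkN
  have hkg := hNg k hkN
  set r := P.slack k y / A k with hr
  have hr0 : 0 < r := div_pos (hypos k hkg) hAk
  have hk0 : P.slack k y - r * A k = 0 := by rw [hr]; field_simp; ring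
  have hpos : ∀ i, i ≠ g → i ≠ k → 0 < P.slack i y - r * A i := by
    intro i hig hik
    rcases le_or_gt (A i) 0 with hi | hi
    · nlinarith [hypos i hig]
    · have h1 := hkmin i ((hN i).2 hi)
      rw [le_div_iff₀ hi] at h1
      refine lt_of_le_of_ne (by linarith) fun h0 => ?_
      refine hgen (i, k) ?_ ?_
      · simp [hik, hkN, (hN i).2 hi]
      · have h2 : P.slack i y = r * A i := by linarith
        have h3 : P.slack k y = r * A k := by linarith
        dsimp only
        rw [h2, h3]
        ring
  have hnonneg : ∀ i, 0 ≤ P.slack i y - r * A i := by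
    intro i
    by_cases h1 : i = g
    · rw [h1, hAg, hyg]; simp
    by_cases h2 : i = k
    · rw [h2, hk0]
    exact (hpos i h1 h2).le
  -- the exit point has homogeneous coordinates `(W, c)`
  set c : ℝ := 1 + r * (P.slack g o - P.slack g z) with hc
  set W : Fin d → ℝ := y + r • (P.slack g o • z - P.slack g z • o) with hW
  have hWeval : ∀ i, P.eval i W = P.slack i y - r * A i + c * P.rhs i := fun i => by
    simp only [hW, hc, hA, eval_add, eval_smul, eval_sub, slack]; ring
  have hoQ : o ∈ P.toSet := (P.mem_toSet_iff_slack o).2 fun i => (ho i).le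
  have hcpos : 0 < c := by
    by_contra hcneg
    push Not at hcneg
    have hrec : W + (-c) • o = 0 := by
      refine eq_zero_of_recession hb hoQ fun i => ?_
      rw [eval_add, eval_smul, hWeval]
      have h1 := hnonneg i
      have h2 := mul_nonneg (neg_nonneg.2 hcneg) (ho i).le
      simp only [slack] at h1 h2 ⊢
      linarith
    have hall : ∀ i, i = g ∨ i = k := by
      intro i
      by_contra! hi
      have h1 := hpos i hi.1 hi.2
      have h2 := mul_nonneg (neg_nonneg.2 hcneg) (ho i).le
      have h3 : P.eval i (W + (-c) • o) = 0 := by rw [hrec, eval_zero]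
      rw [eval_add, eval_smul, hWeval] at h3
      simp only [slack] at h1 h2 h3
      linarith
    obtain ⟨v, hv, hv0⟩ := Submodule.exists_mem_ne_zero_of_ne_bot
      (LinearMap.ker_ne_bot_of_finrank_lt (f := P.evalPair g k) (by simpa using hd))
    rw [mem_ker_evalPair] at hv
    refine hv0 (eq_zero_of_recession hb hoQ fun i => ?_)
    rcases hall i with rfl | rfl
    · exact hv.1.ge
    · exact hv.2.ge
  have hXslack : ∀ i, P.slack i (c⁻¹ • W) = c⁻¹ * (P.slack i y - r * A i) := fun i => by
    rw [slack, eval_smul, hWeval]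
    field_simp
    ring
  refine ⟨k, hP.adjacentFacets hkg (x := c⁻¹ • W) ?_ ?_ ?_, fun x hx => ?_, ?_⟩
  · rw [hXslack, hyg, hAg]; simp
  · rw [hXslack, hk0, mul_zero]
  · intro i hig hik
    rw [hXslack]
    exact mul_pos (inv_pos.2 hcpos) (hpos i hig hik)
  · refine (P.mem_facet_iff_slack k x).2 ⟨hx.1.1, hUsel y hyV.1 k ?_ x hx⟩
    have h1 := hkmin p ((hN p).2 hAp)
    rwa [div_le_div_iff₀ hAk hAp] at h1
  · rw [div_lt_div_iff₀ (ho k) (ho g)]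
    simp only [hA] at hAk
    linarith

end PolyData

/-- A reachable element is reached by a finite sequence of related elements. -/
lemma exists_fin_path_of_reflTransGen {α : Type*} {R : α → α → Prop} {a b : α}
    (h : Relation.ReflTransGen R a b) :
    ∃ (k : ℕ) (F : Fin (k + 1) → α), F 0 = a ∧ F (Fin.last k) = b ∧
      ∀ i : Fin k, R (F i.castSucc) (F i.succ) := by
  induction h with
  | refl => exact ⟨0, fun _ => a, rfl, rfl, fun i => i.elim0⟩
  | @tail b c _ hbc ih =>
    obtain ⟨k, F, h0, hl, hF⟩ := ih
    refine ⟨k + 1, Fin.snoc F c, ?_, by simp, fun i => ?_⟩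
    · rw [← Fin.castSucc_zero, Fin.snoc_castSucc, h0]
    · rw [Fin.snoc_castSucc]
      induction i using Fin.lastCases with
      | last => rw [Fin.succ_last, Fin.snoc_last, hl]; exact hbc
      | cast j => rw [Fin.succ_castSucc, Fin.snoc_castSucc]; exact hF j

/-- Lemma 17: in a `4`-dimensional prismatoid with bases
`Q^+` and `Q^-` there is a facial path from `Q^+` to `Q^-` such that each
step encounters at least one new vertex of `Q^-`. -/
theorem prismatoid_facial_path (f : ℕ) (Q : PolyData 4 f) (hQ : Q.IsProper)
    (hb : Bornology.IsBounded Q.toSet) (ip im : Fin f) (hne : ip ≠ im)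
    (hbases : ∀ w, Q.IsVertex w → w ∈ Q.facet ip ∨ w ∈ Q.facet im) :
    ∃ (k : ℕ) (F : Fin (k+1) → Fin f), F 0 = ip ∧ F (Fin.last k) = im ∧
      (∀ i : Fin k, Q.AdjacentFacets (F i.castSucc) (F i.succ)) ∧
      (∀ i : Fin k, ∃ w, Q.IsVertex w ∧ w ∈ Q.facet im ∧
        w ∈ Q.facet (F i.succ) ∧ w ∉ Q.facet (F i.castSucc)) := by
  obtain ⟨o, ho⟩ := hQ.exists_interior
  obtain ⟨z, hzp, hz⟩ := hQ.exists_relint ip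
  let R : Fin f → Fin f → Prop := fun i j => Q.AdjacentFacets i j ∧
    ∃ w, Q.IsVertex w ∧ w ∈ Q.facet im ∧ w ∈ Q.facet j ∧ w ∉ Q.facet i
  have hreach : ∀ g, Relation.ReflTransGen R ip g := by
    by_contra! hex
    obtain ⟨g, hg, hmin⟩ := Set.exists_min_image {g | ¬ Relation.ReflTransGen R ip g}
      (fun g => Q.slack g z / Q.slack g o) (Set.toFinite _) hex
    have hgp : g ≠ ip := by
      rintro rfl
      exact hg .refl
    obtain ⟨k, hadj, hsub, hlt⟩ := hQ.exists_adjacent_descent (by norm_num) hb hgp hzp hz ho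
    obtain ⟨y, hy, hy'⟩ := hQ.exists_relint g
    have hyQ : y ∈ Q.toSet := by
      rw [PolyData.mem_toSet_iff_slack]
      intro i
      by_cases hi : i = g
      · exact hi ▸ hy.ge
      · exact (hy' i hi).le
    obtain ⟨w, hw, hwg, hwk⟩ := PolyData.exists_vertex_of_slack_pos hb
      ((Q.mem_facet_iff_slack g y).2 ⟨hyQ, hy⟩) (hy' k hadj.1)
    have hwk' : w ∉ Q.facet k := fun h => hwk.ne' ((Q.mem_facet_iff_slack k w).1 h).2
    have hwm : w ∈ Q.facet im := (hbases w hw).resolve_left fun h => hwk' (hsub ⟨hwg, h⟩)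
    have hk : Relation.ReflTransGen R ip k := by
      by_contra hk
      exact absurd hlt (not_lt.2 (hmin k hk))
    exact hg (hk.tail ⟨hadj, w, hw, hwm, hwg, hwk'⟩)
  obtain ⟨k, F, h0, hl, hF⟩ := exists_fin_path_of_reflTransGen (hreach im)
  exact ⟨k, F, h0, hl, fun i => (hF i).1, fun i => (hF i).2⟩
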